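/- If T_n denotes the number of rooted trees with n vertices and T_n^{[h]} the number of rooted trees with n vertices of depth at most h, then T_n ≤ T_{n+1}^{[h]} · n^{n/h} for all positive integers n and h with h ≤ n. -/

import Mathlib

/-- A rooted tree: a root together with a list of rooted subtrees. -/
inductive RTree : Type
  | node : List RTree → RTree

mutual
/-- Number of vertices of a rooted tree. -/
def RTree.size : RTree → ℕ
  | .node l => 1 + RTree.sizeList l
def RTree.sizeList : List RTree → ℕ
  | [] => 0
  | t :: ts => RTree.size t + RTree.sizeList ts
end

mutual
/-- Depth of a rooted tree: maximal distance from the root to a vertex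
(a single vertex has depth 0). -/
def RTree.depth : RTree → ℕ
  | .node l => RTree.depthList l
def RTree.depthList : List RTree → ℕ
  | [] => 0
  | t :: ts => max (RTree.depth t + 1) (RTree.depthList ts)
end

/-- Root-preserving isomorphism of rooted trees: the lists of subtrees of the
roots match up to a permutation and isomorphisms of corresponding subtrees. -/
inductive TreeIso : RTree → RTree → Prop
  | node {l₁ l₂ l₃ : List RTree} (h₁ : List.Forall₂ TreeIso l₁ l₃)
      (h₂ : l₃.Perm l₂) : TreeIso (.node l₁) (.node l₂)

/-- `T n` : the number of rooted trees with `n` vertices, up to isomorphism. -/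
noncomputable def T (n : ℕ) : ℕ :=
  Nat.card (Quot fun t s : {t : RTree // t.size = n} => TreeIso t.1 s.1)

/-- `T' n h` : the number of rooted trees with `n` vertices and depth at most
`h`, up to isomorphism. -/
noncomputable def T' (n h : ℕ) : ℕ :=
  Nat.card (Quot fun t s : {t : RTree // t.size = n ∧ t.depth ≤ h} =>
    TreeIso t.1 s.1)

mutual
/-- A complete isomorphism invariant of rooted trees. -/
def RTree.code : RTree → ℕ
  | .node l => Encodable.encode (RTree.codeList l)
def RTree.codeList : List RTree → Multiset ℕ
  | [] => 0
  | t :: ts => RTree.code t ::ₘ RTree.codeList ts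
end

theorem codeList_eq (l : List RTree) : RTree.codeList l = ((l.map RTree.code : List ℕ) : Multiset ℕ) := by
  induction l with
  | nil => simp [RTree.codeList]
  | cons a l ih => simp [RTree.codeList, ih]

theorem code_node_inj {l l' : List RTree} :
    (RTree.node l).code = (RTree.node l').code ↔ RTree.codeList l = RTree.codeList l' := by
  simp [RTree.code]

/-- Binary induction principle. -/
theorem RTree.ind {P : RTree → Prop} (h0 : P (.node []))
    (h1 : ∀ t ts, P t → P (.node ts) → P (.node (t :: ts))) (t : RTree) : P t :=
  RTree.rec (motive_1 := P) (motive_2 := fun l => P (.node l))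
    (fun _ h => h) h0 (fun t ts ht hts => h1 t ts ht hts) t

theorem sizeList_eq (l : List RTree) : RTree.sizeList l = (l.map RTree.size).sum := by
  induction l with
  | nil => simp [RTree.sizeList]
  | cons a l ih => simp [RTree.sizeList, ih]

theorem iso_code (t : RTree) : ∀ s, TreeIso t s → t.code = s.code ∧ t.size = s.size := by
  refine RTree.rec (motive_1 := fun t => ∀ s, TreeIso t s → t.code = s.code ∧ t.size = s.size)
    (motive_2 := fun l => ∀ l', List.Forall₂ TreeIso l l' →
      RTree.codeList l = RTree.codeList l' ∧ RTree.sizeList l = RTree.sizeList l') ?_ ?_ ?_ t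
  · intro l ih s hs
    cases hs with
    | node h₁ h₂ =>
      obtain ⟨a, b⟩ := ih _ h₁
      constructor
      · rw [code_node_inj, a, codeList_eq, codeList_eq]
        exact Multiset.coe_eq_coe.2 (h₂.map _)
      · simp only [RTree.size]
        rw [b, sizeList_eq, sizeList_eq, (h₂.map _).sum_eq]
  · intro l' h
    cases h
    simp
  · intro t ts ht hts l' h
    cases h with
    | cons h1 h2 =>
      simp [RTree.codeList, RTree.sizeList, ht _ h1, hts _ h2]

theorem code_iso (t : RTree) : ∀ s, t.code = s.code → TreeIso t s := by
  refine RTree.rec (motive_1 := fun t => ∀ s, t.code = s.code → TreeIso t s)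
    (motive_2 := fun l => ∀ l', RTree.codeList l = RTree.codeList l' →
      ∃ l3, List.Forall₂ TreeIso l l3 ∧ l3.Perm l') ?_ ?_ ?_ t
  · intro l ih s hs
    cases s with
    | node l' =>
      obtain ⟨l3, a, b⟩ := ih l' (code_node_inj.1 hs)
      exact TreeIso.node a b
  · intro l' h
    cases l' with
    | nil => exact ⟨[], by simp, by simp⟩
    | cons a l => simp [RTree.codeList] at h
  · intro t ts ht hts l' h
    have hm : t.code ∈ RTree.codeList l' := by
      rw [← h]; simp [RTree.codeList]
    rw [codeList_eq] at hm
    simp only [Multiset.mem_coe, List.mem_map] at hm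
    obtain ⟨s, hs, hc⟩ := hm
    obtain ⟨a, b, rfl⟩ := List.append_of_mem hs
    have h2 : RTree.codeList ts = RTree.codeList (a ++ b) := by
      have h3 : RTree.codeList (a ++ s :: b) = RTree.codeList (s :: (a ++ b)) := by
        rw [codeList_eq, codeList_eq]
        exact Multiset.coe_eq_coe.2 (List.perm_middle.map _)
      rw [h3] at h
      simp only [RTree.codeList, hc] at h
      exact (Multiset.cons_inj_right _).1 h
    obtain ⟨l3, p, q⟩ := hts _ h2
    exact ⟨s :: l3, List.Forall₂.cons (ht _ hc.symm) p,
      (q.cons s).trans List.perm_middle.symm⟩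

/-- Isomorphism classes of rooted trees. -/
def QT : Type := {x : ℕ // ∃ t : RTree, t.code = x}

namespace QT

def mk (t : RTree) : QT := ⟨t.code, t, rfl⟩

theorem mk_eq {t s : RTree} : mk t = mk s ↔ t.code = s.code := by
  unfold mk
  exact Subtype.mk_eq_mk

theorem mk_surj : Function.Surjective mk := by
  rintro ⟨x, t, rfl⟩
  exact ⟨t, rfl⟩

noncomputable def rep (q : QT) : RTree := (mk_surj q).choose

theorem mk_rep (q : QT) : mk q.rep = q := (mk_surj q).choose_spec

noncomputable def sz (q : QT) : ℕ := q.rep.size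

theorem sz_mk (t : RTree) : sz (mk t) = t.size :=
  (iso_code _ _ (code_iso _ _ (mk_eq.1 (mk_rep (mk t))))).2

def kids : RTree → List RTree
  | .node l => l

noncomputable def ch (q : QT) : Multiset QT := ((kids q.rep).map mk : List QT)

theorem map_val (l : List RTree) :
    (((l.map mk : List QT) : Multiset QT)).map (fun q => q.1) = RTree.codeList l := by
  rw [codeList_eq, Multiset.map_coe, List.map_map]
  rfl

theorem val_inj : Function.Injective (fun q : QT => q.1) := fun _ _ h => Subtype.ext h

theorem ch_mk (l : List RTree) : ch (mk (.node l)) = ((l.map mk : List QT) : Multiset QT) := by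
  have h := mk_eq.1 (mk_rep (mk (.node l)))
  unfold ch
  generalize (mk (RTree.node l)).rep = r at h
  cases r with
  | node l' =>
    apply Multiset.map_injective val_inj
    rw [map_val, map_val]
    exact code_node_inj.1 h

theorem ch_inj : Function.Injective ch := by
  intro a b h
  obtain ⟨⟨l⟩, rfl⟩ := mk_surj a
  obtain ⟨⟨l'⟩, rfl⟩ := mk_surj b
  rw [ch_mk, ch_mk] at h
  rw [mk_eq, code_node_inj, ← map_val, h, map_val]

theorem ch_surj (M : Multiset QT) : ∃ q, ch q = M := by
  refine ⟨mk (.node (M.toList.map rep)), ?_⟩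
  rw [ch_mk]
  have : mk ∘ rep = id := funext mk_rep
  simp [this]

noncomputable def nd (M : Multiset QT) : QT := (ch_surj M).choose
theorem ch_nd (M : Multiset QT) : ch (nd M) = M := (ch_surj M).choose_spec

noncomputable def leaf : QT := nd 0
noncomputable def join (q t : QT) : QT := nd (t ::ₘ ch q)

theorem ch_join (q t : QT) : ch (join q t) = t ::ₘ ch q := ch_nd _
theorem ch_leaf : ch leaf = 0 := ch_nd _

theorem mk_nil : mk (.node []) = leaf := by
  apply ch_inj; rw [ch_mk, ch_leaf]; rfl

theorem mk_cons (t : RTree) (ts : List RTree) : mk (.node (t :: ts)) = join (mk (.node ts)) (mk t) := by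
  apply ch_inj; rw [ch_mk, ch_join, ch_mk]; rfl

theorem join_ne_leaf (q t : QT) : join q t ≠ leaf := by
  intro h
  have := congrArg ch h
  rw [ch_join, ch_leaf] at this
  simp at this

theorem join_comm (q a b : QT) : join (join q a) b = join (join q b) a := by
  apply ch_inj
  simp only [ch_join]
  exact Multiset.cons_swap _ _ _

theorem join_eq {q t q' t' : QT} (h : join q t = join q' t') :
    (t = t' ∧ q = q') ∨ ∃ u, q = join u t' ∧ q' = join u t := by
  have h := congrArg ch h
  rw [ch_join, ch_join, Multiset.cons_eq_cons] at h
  rcases h with ⟨a, b⟩ | ⟨_, cs, a, b⟩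
  · exact Or.inl ⟨a, ch_inj b⟩
  · refine Or.inr ⟨nd cs, ch_inj ?_, ch_inj ?_⟩ <;> rw [ch_join, ch_nd] <;> assumption

theorem ind {P : QT → Prop} (h0 : P leaf) (h1 : ∀ q t, P q → P t → P (join q t)) (q : QT) : P q := by
  obtain ⟨t, rfl⟩ := mk_surj q
  induction t using RTree.ind with
  | h0 => rw [mk_nil]; exact h0
  | h1 t ts ht hts => rw [mk_cons]; exact h1 _ _ hts ht

theorem size_cons (t : RTree) (ts : List RTree) :
    (RTree.node (t :: ts)).size = (RTree.node ts).size + t.size := by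
  simp only [RTree.size, RTree.sizeList]; omega

theorem sz_leaf : sz leaf = 1 := by
  rw [← mk_nil, sz_mk]; simp [RTree.size, RTree.sizeList]

theorem sz_join (q t : QT) : sz (join q t) = sz q + sz t := by
  obtain ⟨⟨l⟩, rfl⟩ := mk_surj q
  obtain ⟨t, rfl⟩ := mk_surj t
  rw [← mk_cons, sz_mk, sz_mk, sz_mk, size_cons]

/-- `Dec t t0 P`: cutting some edges of `t` leaves the piece `t0` containing the root, and the
other pieces `P`. -/
inductive Dec : QT → QT → Multiset QT → Prop
  | leaf : Dec leaf leaf 0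
  | addU {q q0 P t t0 P'} : Dec q q0 P → Dec t t0 P' → Dec (join q t) (join q0 t0) (P + P')
  | addM {q q0 P t t0 P'} : Dec q q0 P → Dec t t0 P' → Dec (join q t) q0 (t0 ::ₘ (P + P'))

theorem Dec.refl (q : QT) : Dec q q 0 := by
  induction q using QT.ind with
  | h0 => exact Dec.leaf
  | h1 q t h1 h2 => simpa using Dec.addU h1 h2

theorem Dec.size {t t0 P} (h : Dec t t0 P) : sz t = sz t0 + (P.map sz).sum := by
  induction h with
  | leaf => simp
  | addU h1 h2 ih1 ih2 => simp [sz_join, ih1, ih2]; omega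
  | addM h1 h2 ih1 ih2 => simp [sz_join, ih1, ih2]; omega

theorem Dec.zero {t t0 P} (h : Dec t t0 P) (hP : P = 0) : t = t0 := by
  induction h with
  | leaf => rfl
  | addU h1 h2 ih1 ih2 =>
    simp only [add_eq_zero] at hP
    rw [ih1 hP.1, ih2 hP.2]
  | addM h1 h2 ih1 ih2 => simp at hP

theorem Dec.unmark {t t0 P} (h : Dec t t0 P) : ∀ {y R}, P = y ::ₘ R →
    (∃ w, Dec w t0 {y} ∧ Dec t w R) ∨
    (∃ z R' w, R = z ::ₘ R' ∧ Dec w z {y} ∧ Dec t t0 (w ::ₘ R')) := by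
  induction h with
  | leaf => intro y R h; simp at h
  | @addU q q0 P t t0 P' h1 h2 ih1 ih2 =>
    intro y R h
    have hy : y ∈ P + P' := by rw [h]; simp
    rcases Multiset.mem_add.1 hy with hy | hy
    · obtain ⟨S, rfl⟩ := Multiset.exists_cons_of_mem hy
      rw [Multiset.cons_add, Multiset.cons_inj_right] at h
      subst h
      rcases ih1 rfl with ⟨w, a, b⟩ | ⟨z, R', w, rfl, a, b⟩
      · exact Or.inl ⟨join w t0, by simpa using Dec.addU a (Dec.refl t0), Dec.addU b h2⟩
      · exact Or.inr ⟨z, R' + P', w, by simp, a, by simpa using Dec.addU b h2⟩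
    · obtain ⟨S, rfl⟩ := Multiset.exists_cons_of_mem hy
      rw [Multiset.add_cons, Multiset.cons_inj_right] at h
      subst h
      rcases ih2 rfl with ⟨w, a, b⟩ | ⟨z, R', w, rfl, a, b⟩
      · exact Or.inl ⟨join q0 w, by simpa using Dec.addU (Dec.refl q0) a, Dec.addU h1 b⟩
      · exact Or.inr ⟨z, P + R', w, by simp, a, by simpa using Dec.addU h1 b⟩
  | @addM q q0 P t t0 P' h1 h2 ih1 ih2 =>
    intro y R h
    have hy : y ∈ t0 ::ₘ (P + P') := by rw [h]; simp
    rcases Multiset.mem_cons.1 hy with hy | hy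
    · subst hy
      rw [Multiset.cons_inj_right] at h
      subst h
      exact Or.inl ⟨join q0 y, by simpa using Dec.addM (Dec.refl q0) (Dec.refl y), Dec.addU h1 h2⟩
    rcases Multiset.mem_add.1 hy with hy | hy
    · obtain ⟨S, rfl⟩ := Multiset.exists_cons_of_mem hy
      rw [Multiset.cons_add, Multiset.cons_swap, Multiset.cons_inj_right] at h
      subst h
      rcases ih1 rfl with ⟨w, a, b⟩ | ⟨z, R', w, rfl, a, b⟩
      · exact Or.inl ⟨w, a, Dec.addM b h2⟩
      · refine Or.inr ⟨z, t0 ::ₘ (R' + P'), w, ?_, a, ?_⟩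
        · rw [Multiset.cons_add, Multiset.cons_swap]
        · rw [Multiset.cons_swap, ← Multiset.cons_add]; exact Dec.addM b h2
    · obtain ⟨S, rfl⟩ := Multiset.exists_cons_of_mem hy
      rw [Multiset.add_cons, Multiset.cons_swap, Multiset.cons_inj_right] at h
      subst h
      rcases ih2 rfl with ⟨w, a, b⟩ | ⟨z, R', w, rfl, a, b⟩
      · exact Or.inr ⟨t0, P + S, w, rfl, a, Dec.addM h1 b⟩
      · refine Or.inr ⟨z, t0 ::ₘ (P + R'), w, ?_, a, ?_⟩
        · rw [Multiset.add_cons, Multiset.cons_swap]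
        · rw [Multiset.cons_swap, ← Multiset.add_cons]; exact Dec.addM h1 b

theorem add_eq_single {P P' : Multiset QT} {y : QT} (h : P + P' = {y}) :
    (P = {y} ∧ P' = 0) ∨ (P = 0 ∧ P' = {y}) := by
  have hy : y ∈ P + P' := by rw [h]; simp
  rcases Multiset.mem_add.1 hy with hy | hy
  · obtain ⟨S, rfl⟩ := Multiset.exists_cons_of_mem hy
    rw [← Multiset.cons_zero, Multiset.cons_add, Multiset.cons_inj_right, add_eq_zero] at h
    exact Or.inl ⟨by rw [h.1]; rfl, h.2⟩
  · obtain ⟨S, rfl⟩ := Multiset.exists_cons_of_mem hy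
    rw [← Multiset.cons_zero, Multiset.add_cons, Multiset.cons_inj_right, add_eq_zero] at h
    exact Or.inr ⟨h.1, by rw [h.2]; rfl⟩

theorem cons_eq_single {P P' : Multiset QT} {y t : QT} (h : t ::ₘ (P + P') = {y}) :
    t = y ∧ P = 0 ∧ P' = 0 := by
  have : t = y := by
    have : t ∈ ({y} : Multiset QT) := by rw [← h]; simp
    simpa using this
  subst this
  rw [← Multiset.cons_zero, Multiset.cons_inj_right, add_eq_zero] at h
  exact ⟨rfl, h⟩

theorem Dec.graft_leaf {w x P} (h : Dec w x P) {y} (hP : P = {y}) (hx : x = QT.leaf) :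
    w = join QT.leaf y := by
  cases h with
  | leaf => simp at hP
  | addU h1 h2 => exact absurd hx (join_ne_leaf _ _)
  | addM h1 h2 =>
    obtain ⟨rfl, rfl, rfl⟩ := cons_eq_single hP
    rw [h1.zero rfl, h2.zero rfl, hx]

theorem Dec.graft_join {w x P} (h : Dec w x P) : ∀ {y q c}, P = {y} → x = join q c →
    (∃ w', Dec w' q {y} ∧ w = join w' c) ∨ (∃ w', Dec w' c {y} ∧ w = join q w') := by
  induction h with
  | leaf => intro y q c h; simp at h
  | @addU q q0 P t t0 P' h1 h2 ih1 ih2 =>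
    intro y a c hP hx
    rcases add_eq_single hP with ⟨rfl, rfl⟩ | ⟨rfl, rfl⟩
    · have := h2.zero rfl
      subst this
      rcases join_eq hx with ⟨rfl, rfl⟩ | ⟨u, rfl, rfl⟩
      · exact Or.inl ⟨q, h1, rfl⟩
      · rcases ih1 rfl rfl with ⟨w', d, rfl⟩ | ⟨w', d, rfl⟩
        · exact Or.inl ⟨join w' t, by simpa using Dec.addU d (Dec.refl t), join_comm _ _ _⟩
        · exact Or.inr ⟨w', d, join_comm _ _ _⟩
    · have := h1.zero rfl
      subst this
      rcases join_eq hx with ⟨rfl, rfl⟩ | ⟨u, rfl, rfl⟩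
      · exact Or.inr ⟨t, h2, rfl⟩
      · exact Or.inl ⟨join u t, by simpa using Dec.addU (Dec.refl u) h2, join_comm _ _ _⟩
  | @addM q q0 P t t0 P' h1 h2 ih1 ih2 =>
    intro y a c hP hx
    obtain ⟨rfl, rfl, rfl⟩ := cons_eq_single hP
    have e1 := h1.zero rfl
    have e2 := h2.zero rfl
    subst e1 e2 hx
    exact Or.inl ⟨join a t, by simpa using Dec.addM (Dec.refl a) (Dec.refl t), join_comm _ _ _⟩

/-- `s` has at most `k` elements. -/
def CL (s : Set QT) (k : ℕ) : Prop := s.encard ≤ (k : ℕ∞)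

theorem CL.mono {s t : Set QT} {k l : ℕ} (h : CL t k) (hs : s ⊆ t) (hk : k ≤ l) : CL s l :=
  (Set.encard_le_encard hs).trans (le_trans h (by exact_mod_cast hk))

theorem CL.union {s t : Set QT} {k l : ℕ} (h : CL s k) (h' : CL t l) : CL (s ∪ t) (k + l) := by
  unfold CL at *
  refine (Set.encard_union_le s t).trans ?_
  push_cast
  exact add_le_add h h'

theorem CL.image {s : Set QT} {k : ℕ} (f : QT → QT) (h : CL s k) : CL (f '' s) k :=
  (Set.encard_image_le f s).trans h

theorem CL.single (x : QT) : CL {x} 1 := by simp [CL]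

theorem CL.sUnion (M : Multiset QT) (f : QT → Set QT) (g : QT → ℕ) (h : ∀ x ∈ M, CL (f x) (g x)) :
    CL {q | ∃ x ∈ M, q ∈ f x} (M.map g).sum := by
  induction M using Multiset.induction with
  | empty => simp [CL]
  | cons a M ih =>
    have := (h a (by simp)).union (ih fun x hx => h x (by simp [hx]))
    refine this.mono ?_ (by simp)
    rintro q ⟨x, hx, hq⟩
    rcases Multiset.mem_cons.1 hx with rfl | hx
    · exact Or.inl hq
    · exact Or.inr ⟨x, hx, hq⟩

theorem CL.sUnion' {s : Set QT} {k l : ℕ} (hs : CL s k) (f : QT → Set QT)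
    (h : ∀ x ∈ s, CL (f x) l) : CL {q | ∃ x ∈ s, q ∈ f x} (k * l) := by
  have hfin : s.Finite := Set.finite_of_encard_le_coe hs
  have := CL.sUnion hfin.toFinset.1 f (fun _ => l) (fun x hx => h x (by simpa using hx))
  refine this.mono ?_ ?_
  · rintro q ⟨x, hx, hq⟩
    exact ⟨x, by simpa using hx, hq⟩
  · simp only [Multiset.map_const', Multiset.sum_replicate, smul_eq_mul]
    apply Nat.mul_le_mul_right
    unfold CL at hs
    rw [hfin.encard_eq_coe_toFinset_card] at hs
    exact_mod_cast hs

def D (t0 : QT) (P : Multiset QT) : Set QT := {t | Dec t t0 P}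

theorem D_zero (t0 : QT) : CL (D t0 0) 1 := by
  refine (CL.single t0).mono ?_ le_rfl
  intro t h
  exact Dec.zero h rfl

theorem D_single (z y : QT) : CL (D z {y}) (sz z) := by
  induction z using QT.ind with
  | h0 =>
    refine (CL.single (join leaf y)).mono ?_ (by rw [sz_leaf])
    intro t h
    exact Dec.graft_leaf h rfl rfl
  | h1 q c h1 h2 =>
    refine ((h1.image (fun w => join w c)).union (h2.image (fun w => join q w))).mono ?_
      (by rw [sz_join])
    intro t h
    rcases Dec.graft_join h rfl rfl with ⟨w, a, rfl⟩ | ⟨w, a, rfl⟩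
    · exact Or.inl ⟨w, a, rfl⟩
    · exact Or.inr ⟨w, a, rfl⟩

theorem sz_erase {M : Multiset QT} {z : QT} {R : Multiset QT} (h : M = z ::ₘ R) :
    (M.map sz).sum = sz z + (R.map sz).sum := by simp [h]

theorem D_bound (k : ℕ) : ∀ (t0 : QT) (M : Multiset QT), M.card = k + 1 →
    CL (D t0 M) (sz t0 * (sz t0 + (M.map sz).sum) ^ k) := by
  classical
  induction k with
  | zero =>
    intro t0 M hM
    obtain ⟨y, rfl⟩ := Multiset.card_eq_one.1 hM
    simpa using D_single t0 y
  | succ k ih =>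
    intro t0 M hM
    obtain ⟨y, hy⟩ := Multiset.card_pos_iff_exists_mem.1 (by omega : 0 < M.card)
    obtain ⟨M', rfl⟩ := Multiset.exists_cons_of_mem hy
    have hM' : M'.card = k + 1 := by simpa using hM
    set n := sz t0 + ((y ::ₘ M').map sz).sum with hn
    have A : CL {q | ∃ w ∈ D t0 {y}, q ∈ D w M'} (sz t0 * ((sz t0 + sz y) * n ^ k)) := by
      apply (D_single t0 y).sUnion'
      intro w hw
      have e : sz w = sz t0 + sz y := by simpa using Dec.size hw
      have := ih w M' hM'
      rw [e] at this
      rwa [hn, Multiset.map_cons, Multiset.sum_cons, ← add_assoc]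
    have B : CL {q | ∃ z ∈ M', q ∈ {q | ∃ w ∈ D z {y}, q ∈ D t0 (w ::ₘ M'.erase z)}}
        ((M'.map fun z => sz z * (sz t0 * n ^ k)).sum) := by
      apply CL.sUnion
      intro z hz
      apply (D_single z y).sUnion'
      intro w hw
      have e : sz w = sz z + sz y := by simpa using Dec.size hw
      have hz' := Multiset.cons_erase hz
      have := ih t0 (w ::ₘ M'.erase z) (by
        rw [← hM', ← congrArg Multiset.card hz']; simp)
      convert this using 3
      rw [hn, Multiset.map_cons, Multiset.sum_cons, Multiset.map_cons, Multiset.sum_cons,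
        sz_erase hz'.symm, e]
      ring
    refine (A.union B).mono ?_ ?_
    · intro q hq
      rcases Dec.unmark hq rfl with ⟨w, a, b⟩ | ⟨z, R', w, rfl, a, b⟩
      · exact Or.inl ⟨w, a, b⟩
      · exact Or.inr ⟨z, by simp, w, a, by simpa [D] using b⟩
    · rw [Multiset.sum_map_mul_right]
      apply le_of_eq
      have e : n = sz t0 + (sz y + (M'.map sz).sum) := by
        rw [hn, Multiset.map_cons, Multiset.sum_cons]
      have e2 : n ^ (k + 1) = (sz t0 + (sz y + (M'.map sz).sum)) * n ^ k := by
        rw [pow_succ, mul_comm, ← e]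
      rw [e2]
      ring

theorem E_bound (C : Multiset QT) (k n : ℕ) (hC : C.card = k + 1) (hn : (C.map sz).sum = n) :
    CL {q | ∃ x P, C = x ::ₘ P ∧ Dec q x P} (n ^ k) := by
  classical
  cases k with
  | zero =>
    obtain ⟨y, rfl⟩ := Multiset.card_eq_one.1 hC
    refine (D_zero y).mono ?_ (by simp)
    rintro q ⟨x, P, h, hd⟩
    rw [← Multiset.cons_zero, Multiset.cons_eq_cons] at h
    rcases h with ⟨rfl, rfl⟩ | ⟨_, cs, h, _⟩
    · exact hd
    · simp at h
  | succ k =>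
    have := CL.sUnion C (fun x => D x (C.erase x)) (fun x => sz x * n ^ k) (by
      intro x hx
      have hx' := Multiset.cons_erase hx
      have := D_bound k x (C.erase x) (by
        have := congrArg Multiset.card hx'
        simp only [Multiset.card_cons] at this
        omega)
      rwa [← sz_erase hx'.symm, hn] at this)
    refine this.mono ?_ ?_
    · rintro q ⟨x, P, rfl, hd⟩
      exact ⟨x, by simp, by simpa [D] using hd⟩
    · rw [Multiset.sum_map_mul_right, hn, pow_succ]
      exact le_of_eq (mul_comm _ _)

theorem cover (h : ℕ) (t : RTree) : ∃ (t0 : ℕ → RTree) (P : ℕ → List RTree),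
    (∀ r ≤ h, Dec (mk t) (mk (t0 r)) ((P r).map mk : List QT) ∧ (t0 r).depth ≤ r ∧
      ∀ p ∈ P r, p.depth ≤ h) ∧ ∑ r ∈ Finset.range (h + 1), (P r).length + 1 = t.size := by
  induction t using RTree.ind with
  | h0 =>
    refine ⟨fun _ => .node [], fun _ => [], ?_, ?_⟩
    · intro r _
      refine ⟨?_, by simp [RTree.depth, RTree.depthList], by simp⟩
      exact Dec.refl _
    · simp [RTree.size, RTree.sizeList]
  | h1 t ts ht hts =>
    obtain ⟨a, A, hA, hA'⟩ := ht
    obtain ⟨b, B, hB, hB'⟩ := hts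
    refine ⟨fun r => match r with
        | 0 => b 0
        | r + 1 => .node (a r :: kids (b (r + 1))),
      fun r => match r with
        | 0 => a h :: (B 0 ++ A h)
        | r + 1 => B (r + 1) ++ A r, ?_, ?_⟩
    · intro r hr
      cases r with
      | zero =>
        obtain ⟨h1, h2, h3⟩ := hB 0 hr
        obtain ⟨g1, g2, g3⟩ := hA h le_rfl
        refine ⟨?_, h2, ?_⟩
        · rw [mk_cons]
          have := Dec.addM h1 g1
          simpa using this
        · intro p hp
          simp only [List.mem_cons, List.mem_append] at hp
          rcases hp with rfl | hp | hp
          · exact g2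
          · exact h3 p hp
          · exact g3 p hp
      | succ r =>
        obtain ⟨h1, h2, h3⟩ := hB (r + 1) hr
        obtain ⟨g1, g2, g3⟩ := hA r (by omega)
        refine ⟨?_, ?_, ?_⟩
        · rw [mk_cons, mk_cons]
          have := Dec.addU h1 g1
          have e : RTree.node (kids (b (r + 1))) = b (r + 1) := by
            cases b (r + 1); rfl
          simpa [e] using this
        · have e : RTree.depthList (kids (b (r + 1))) = (b (r + 1)).depth := by
            cases b (r + 1); simp [kids, RTree.depth]
          simp only [RTree.depth, RTree.depthList, e]
          omega
        · intro p hp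
          rcases List.mem_append.1 hp with hp | hp
          · exact h3 p hp
          · exact g3 p hp
    · rw [size_cons, ← hA', ← hB', Finset.sum_range_succ' _ h, Finset.sum_range_succ' (fun r => (B r).length) h, Finset.sum_range_succ (fun r => (A r).length) h]
      simp only [List.length_append, List.length_cons, Finset.sum_add_distrib]
      omega

theorem one_le_size (t : RTree) : 1 ≤ t.size := by
  cases t; simp only [RTree.size]; omega

theorem fin_list (N : ℕ) (hA : {t : RTree | t.size ≤ N}.Finite) (M : ℕ) (hM : M ≤ N) :
    {l : List RTree | RTree.sizeList l ≤ M}.Finite := by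
  induction M with
  | zero =>
    refine (Set.finite_singleton []).subset ?_
    intro l hl
    cases l with
    | nil => rfl
    | cons a l =>
      have := one_le_size a
      simp only [Set.mem_ofPred_eq, RTree.sizeList] at hl
      omega
  | succ M ih =>
    refine ((Set.finite_singleton []).union (Set.Finite.image2 List.cons hA (ih (by omega)))).subset ?_
    intro l hl
    cases l with
    | nil => exact Or.inl rfl
    | cons a l =>
      have := one_le_size a
      simp only [Set.mem_ofPred_eq, RTree.sizeList] at hl
      refine Or.inr ⟨a, ?_, l, ?_, rfl⟩ <;> simp only [Set.mem_ofPred_eq] <;> omega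

theorem fin_tree (N : ℕ) : {t : RTree | t.size ≤ N}.Finite := by
  induction N with
  | zero =>
    refine Set.finite_empty.subset ?_
    intro t ht
    have := one_le_size t
    simp only [Set.mem_ofPred_eq] at ht
    omega
  | succ N ih =>
    refine ((fin_list N ih N le_rfl).image RTree.node).subset ?_
    rintro ⟨l⟩ hl
    simp only [Set.mem_ofPred_eq, RTree.size] at hl
    exact ⟨l, by simp only [Set.mem_ofPred_eq]; omega, rfl⟩

theorem card_quot (p : RTree → Prop) :
    Nat.card (Quot fun t s : {t : RTree // p t} => TreeIso t.1 s.1) = (mk '' {t | p t}).ncard := by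
  rw [← Nat.card_coe_set_eq]
  let f : (Quot fun t s : {t : RTree // p t} => TreeIso t.1 s.1) → (mk '' {t | p t}) :=
    Quot.lift (fun t => ⟨mk t.1, t.1, t.2, rfl⟩) (by
      intro a b hab
      exact Subtype.ext (mk_eq.2 (iso_code _ _ hab).1))
  apply Nat.card_congr (Equiv.ofBijective f ⟨?_, ?_⟩)
  · rintro ⟨a⟩ ⟨b⟩ hab
    apply Quot.sound
    exact code_iso _ _ (mk_eq.1 (congrArg Subtype.val hab))
  · rintro ⟨_, t, ht, rfl⟩
    exact ⟨Quot.mk _ ⟨t, ht⟩, rfl⟩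

theorem depthList_le (l : List RTree) (h : ℕ) (hl : ∀ p ∈ l, p.depth ≤ h) :
    RTree.depthList l ≤ h + 1 := by
  induction l with
  | nil => simp [RTree.depthList]
  | cons a l ih =>
    have := ih fun p hp => hl p (by simp [hp])
    have := hl a (by simp)
    simp only [RTree.depthList]
    omega

theorem ch_sum (q : QT) : sz q = 1 + ((ch q).map sz).sum := by
  induction q using QT.ind with
  | h0 => simp [sz_leaf, ch_leaf]
  | h1 q t h1 h2 => rw [sz_join, ch_join, Multiset.map_cons, Multiset.sum_cons, h1]; omega

theorem main (n h : ℕ) (hn : 1 ≤ n) :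
    T n ≤ T' (n + 1) (h + 1) * n ^ (n / (h + 1)) := by
  unfold T T'
  rw [card_quot (fun t => t.size = n),
    card_quot (fun t => t.size = n + 1 ∧ t.depth ≤ h + 1)]
  set X := mk '' {t | t.size = n + 1 ∧ t.depth ≤ h + 1} with hX
  have hfin : X.Finite := ((fin_tree (n + 1)).subset (fun t ht => ht.1.le)).image mk
  have hXc : CL X X.ncard := by
    unfold CL; rw [hfin.cast_ncard_eq]
  have key := hXc.sUnion' (l := n ^ (n / (h + 1)))
    (fun s => {q | (ch s).card ≤ n / (h + 1) + 1 ∧ ∃ x P, ch s = x ::ₘ P ∧ Dec q x P}) (by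
      rintro s ⟨t, ⟨ht, _⟩, rfl⟩
      have e := ch_sum (mk t)
      rw [sz_mk, ht] at e
      by_cases hc : (ch (mk t)).card ≤ n / (h + 1) + 1 ∧ 1 ≤ (ch (mk t)).card
      · obtain ⟨k, hk⟩ : ∃ k, (ch (mk t)).card = k + 1 := ⟨(ch (mk t)).card - 1, by omega⟩
        refine (E_bound (ch (mk t)) k n hk (by omega)).mono (fun q hq => hq.2) ?_
        exact Nat.pow_le_pow_right hn (by omega)
      · have : CL ∅ 0 := by simp [CL]
        refine this.mono ?_ (Nat.zero_le _)
        rintro q ⟨a, x, P, b, _⟩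
        apply hc
        refine ⟨a, ?_⟩
        rw [b]; simp)
  have sub : mk '' {t | t.size = n} ⊆
      {q | ∃ x ∈ X, q ∈ {q | (ch x).card ≤ n / (h + 1) + 1 ∧
        ∃ y P, ch x = y ::ₘ P ∧ Dec q y P}} := by
    rintro _ ⟨t, ht, rfl⟩
    obtain ⟨t0, P, hP, hs⟩ := cover h t
    simp only [Set.mem_ofPred_eq] at ht
    obtain ⟨r, hr, hle⟩ : ∃ r ∈ Finset.range (h + 1), (P r).length ≤ n / (h + 1) := by
      by_contra! hcon
      have := Finset.sum_le_sum (f := fun _ => n / (h + 1) + 1) (fun r hr => hcon r hr)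
      simp only [Finset.sum_const, Finset.card_range, smul_eq_mul] at this
      have h2 := Nat.lt_mul_div_succ n (Nat.succ_pos h)
      simp only [Nat.succ_eq_add_one] at h2
      omega
    obtain ⟨d, e1, e2⟩ := hP r (by simpa [Nat.lt_succ_iff] using hr)
    refine ⟨mk (.node (t0 r :: P r)), ⟨_, ⟨?_, ?_⟩, rfl⟩, ?_, mk (t0 r), ((P r).map mk : List QT), ?_, d⟩
    · have := d.size
      rw [sz_mk, sz_mk, ht] at this
      simp only [RTree.size, RTree.sizeList, sizeList_eq]
      rw [this]
      simp only [Multiset.map_coe, List.map_map, Multiset.sum_coe]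
      have : sz ∘ mk = RTree.size := funext sz_mk
      rw [this]; omega
    · simp only [RTree.depth]
      apply depthList_le
      intro p hp
      rcases List.mem_cons.1 hp with rfl | hp
      · have : r ≤ h := by simpa [Nat.lt_succ_iff] using hr
        omega
      · exact e2 p hp
    · rw [ch_mk]; simpa using hle
    · rw [ch_mk]; rfl
  have fin := key.mono sub le_rfl
  unfold CL at fin
  have hf := Set.finite_of_encard_le_coe fin
  rw [← hf.cast_ncard_eq] at fin
  exact_mod_cast fin

end QT

theorem stmt_10 (n h : ℕ) (hn : 1 ≤ n) (hh : 1 ≤ h) (hhn : h ≤ n) :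
    (T n : ℝ) ≤ (T' (n + 1) h : ℝ) * (n : ℝ) ^ ((n : ℝ) / (h : ℝ)) := by
  obtain ⟨k, rfl⟩ : ∃ k, h = k + 1 := ⟨h - 1, by omega⟩
  have h1 : (T n : ℝ) ≤ (T' (n + 1) (k + 1) : ℝ) * (n : ℝ) ^ (n / (k + 1)) := by
    exact_mod_cast QT.main n k hn
  refine h1.trans (mul_le_mul_of_nonneg_left ?_ (Nat.cast_nonneg _))
  rw [← Real.rpow_natCast]
  exact Real.rpow_le_rpow_of_exponent_le (by exact_mod_cast hn) Nat.cast_div_le
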